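/- arXiv:2506.10595 — 3 statements merged into one kernel-verified Lean document; each statement's English description precedes it below -/
import Mathlib

section
/- Let H be a complex Hilbert space and let T be a densely defined symmetric unbounded operator on H (a linear partial map whose domain is dense, satisfying ⟪Tφ, ψ⟫ = ⟪φ, Tψ⟫ for all φ, ψ in the domain). Then the following are equivalent: (i) T is self-adjoint, i.e. T equals its adjoint T*; (ii) the graph of T is closed and ker(T* + i·𝟙) = ker(T* − i·𝟙) = {0}; (iii) the ranges of T + i·𝟙 and T − i·𝟙 are all of H. -/
open scoped ComplexInnerProductSpace

theorem aux_norm {H : Type*} [NormedAddCommGroup H] [InnerProductSpace ℂ H]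
    (c : ℂ) (hc : c = Complex.I ∨ c = -Complex.I) (x y : H) (h : ⟪y, x⟫ = ⟪x, y⟫) :
    ‖y + c • x‖ ^ 2 = ‖y‖ ^ 2 + ‖x‖ ^ 2 := by
  have him : (⟪y, x⟫ : ℂ).im = 0 := by
    have h1 := inner_conj_symm (𝕜 := ℂ) y x
    rw [← h] at h1
    have h2 := congrArg Complex.im h1
    simp only [Complex.conj_im] at h2
    linarith
  have hn : ‖c‖ = 1 := by rcases hc with rfl | rfl <;> simp
  rw [norm_add_sq (𝕜 := ℂ), inner_smul_right, norm_smul, hn]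
  have : RCLike.re (c * ⟪y, x⟫) = 0 := by
    rcases hc with rfl | rfl <;> simp [him]
  rw [this]; ring

theorem aux_surj {H : Type*} [NormedAddCommGroup H] [InnerProductSpace ℂ H] [CompleteSpace H]
    (T : H →ₗ.[ℂ] H) (hdense : Dense (T.domain : Set H))
    (hsymm : ∀ φ ψ : T.domain, ⟪T φ, (ψ : H)⟫ = ⟪(φ : H), T ψ⟫)
    (c : ℂ) (hc : c = Complex.I ∨ c = -Complex.I) (hcl : T.IsClosed)
    (hk : ∀ φ : T.adjoint.domain, T.adjoint φ - c • (φ : H) = 0 → (φ : H) = 0) (y : H) :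
    ∃ ψ : T.domain, T ψ + c • (ψ : H) = y := by
  let L : T.graph →L[ℂ] H :=
    (ContinuousLinearMap.snd ℂ H H + c • ContinuousLinearMap.fst ℂ H H).comp T.graph.subtypeL
  have hL : ∀ p : T.graph, L p = (p : H × H).2 + c • (p : H × H).1 := fun p => rfl
  have hcomp : CompleteSpace T.graph := IsClosed.completeSpace_coe (hs := hcl)
  have hanti : AntilipschitzWith 1 L := by
    refine ContinuousLinearMap.antilipschitz_of_bound L fun p => ?_
    obtain ⟨ψ, h1, h2⟩ := (LinearPMap.mem_graph_iff T).1 p.2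
    have hn := aux_norm c hc (p : H × H).1 (p : H × H).2 (by rw [← h1, ← h2]; exact hsymm ψ ψ)
    rw [hL, Submodule.coe_norm, Prod.norm_def, NNReal.coe_one, one_mul]
    refine max_le ?_ ?_ <;> refine le_of_sq_le_sq ?_ (norm_nonneg _) <;> rw [hn]
    · nlinarith [sq_nonneg ‖(p : H × H).2‖]
    · nlinarith [sq_nonneg ‖(p : H × H).1‖]
  have hclosed : IsClosed ((LinearMap.range L.toLinearMap : Submodule ℂ H) : Set H) := by
    have := hanti.isClosed_range L.uniformContinuous
    rw [LinearMap.coe_range]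
    exact this
  have hcs : CompleteSpace (LinearMap.range L.toLinearMap) :=
    IsClosed.completeSpace_coe (hs := hclosed)
  have htop : LinearMap.range L.toLinearMap = ⊤ := by
    rw [← Submodule.orthogonal_eq_bot_iff, Submodule.eq_bot_iff]
    intro φ hφ
    have key : ∀ ψ : T.domain, ⟪c • φ, (ψ : H)⟫ = ⟪φ, T ψ⟫ := by
      intro ψ
      have h0 := (Submodule.mem_orthogonal' _ _).1 hφ (L ⟨((ψ : H), T ψ), T.mem_graph ψ⟩) ⟨_, rfl⟩
      rw [hL, inner_add_right, inner_smul_right] at h0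
      rw [inner_smul_left]
      have : (starRingEnd ℂ) c = -c := by rcases hc with rfl | rfl <;> simp
      rw [this]
      linear_combination -h0
    have hm := LinearPMap.mem_adjoint_domain_of_exists (T := T) φ ⟨_, key⟩
    have := LinearPMap.adjoint_apply_eq hdense ⟨φ, hm⟩ key
    exact hk ⟨φ, hm⟩ (by rw [this]; simp)
  obtain ⟨p, hp⟩ : y ∈ LinearMap.range L.toLinearMap := htop ▸ Submodule.mem_top
  obtain ⟨ψ, h1, h2⟩ := (LinearPMap.mem_graph_iff T).1 p.2
  refine ⟨ψ, ?_⟩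
  rw [h1, h2]
  exact hp

/-- basic criterion for self-adjointness. For a densely defined symmetric
operator `T` on a complex Hilbert space `H`, the following are equivalent:
(i) `T` is self-adjoint (`T† = T`);
(ii) `T` is closed and `ker (T* + i) = ker (T* - i) = {0}`;
(iii) `im (T + i) = im (T - i) = H`. -/
theorem stmt_0 {H : Type*} [NormedAddCommGroup H] [InnerProductSpace ℂ H] [CompleteSpace H]
    (T : H →ₗ.[ℂ] H) (hdense : Dense (T.domain : Set H))
    (hsymm : ∀ φ ψ : T.domain, ⟪T φ, (ψ : H)⟫ = ⟪(φ : H), T ψ⟫) :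
    [ T.adjoint = T,
      T.IsClosed ∧
        (∀ φ : T.adjoint.domain, T.adjoint φ + Complex.I • (φ : H) = 0 → (φ : H) = 0) ∧
        (∀ φ : T.adjoint.domain, T.adjoint φ - Complex.I • (φ : H) = 0 → (φ : H) = 0),
      (∀ y : H, ∃ ψ : T.domain, T ψ + Complex.I • (ψ : H) = y) ∧
        (∀ y : H, ∃ ψ : T.domain, T ψ - Complex.I • (ψ : H) = y) ].TFAE := by
  have hle : T ≤ T.adjoint :=
    LinearPMap.IsFormalAdjoint.le_adjoint hdense (fun x y => hsymm x y)
  have hker : ∀ c : ℂ, (c = Complex.I ∨ c = -Complex.I) → ∀ φ : T.domain,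
      T φ + c • (φ : H) = 0 → (φ : H) = 0 := by
    intro c hc φ h
    have := aux_norm c hc (φ : H) (T φ) (hsymm φ φ)
    rw [h, norm_zero] at this
    have h2 : ‖(φ : H)‖ ^ 2 = 0 := by nlinarith [sq_nonneg ‖T φ‖, sq_nonneg ‖(φ : H)‖]
    simpa using h2
  tfae_have 1 → 2 := by
    intro h
    refine ⟨IsSelfAdjoint.isClosed (LinearPMap.isSelfAdjoint_def.2 h), ?_, ?_⟩
    · rw [h]
      exact hker _ (Or.inl rfl)
    · rw [h]
      intro φ hφ
      exact hker _ (Or.inr rfl) φ (by rw [neg_smul, ← sub_eq_add_neg]; exact hφ)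
  tfae_have 2 → 3 := by
    rintro ⟨hcl, h1, h2⟩
    refine ⟨aux_surj T hdense hsymm _ (Or.inl rfl) hcl h2, fun y => ?_⟩
    obtain ⟨ψ, hψ⟩ := aux_surj T hdense hsymm _ (Or.inr rfl) hcl
      (fun φ hφ => h1 φ (by rw [neg_smul, sub_neg_eq_add] at hφ; exact hφ)) y
    exact ⟨ψ, by rw [← hψ, neg_smul, sub_eq_add_neg]⟩
  tfae_have 3 → 1 := by
    rintro ⟨h1, h2⟩
    refine (LinearPMap.eq_of_le_of_domain_eq hle (le_antisymm hle.1 fun φ hφ => ?_)).symm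
    obtain ⟨ψ, hψ⟩ := h2 (T.adjoint ⟨φ, hφ⟩ - Complex.I • φ)
    obtain ⟨χ, hχ⟩ := h1 (φ - ψ)
    have e1 := LinearPMap.adjoint_isFormalAdjoint hdense ⟨φ, hφ⟩ χ
    have e2 := hsymm ψ χ
    have e3 : T.adjoint ⟨φ, hφ⟩ - T ψ = Complex.I • (φ - (ψ : H)) := by
      rw [smul_sub, sub_eq_sub_iff_add_eq_add]
      have := hψ
      rw [sub_eq_sub_iff_add_eq_add] at this
      rw [← this, add_comm]
    have e4 : ⟪φ - (ψ : H), φ - (ψ : H)⟫ = 0 := by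
      have e5 : ⟪T.adjoint ⟨φ, hφ⟩ - T ψ, (χ : H)⟫ = ⟪φ - (ψ : H), T χ⟫ := by
        rw [inner_sub_left, inner_sub_left, e1, e2]
      rw [e3, inner_smul_left, Complex.conj_I] at e5
      nth_rewrite 2 [← hχ]
      rw [inner_add_right, inner_smul_right, ← e5]
      ring
    have e6 : φ = ψ := sub_eq_zero.1 (inner_self_eq_zero.1 e4)
    rw [e6]
    exact ψ.2
  tfae_finish
end

section
/- Let H be a complex Hilbert space and let T be a densely defined symmetric unbounded operator on H. Then the following are equivalent: (i) T is essentially self-adjoint, i.e. the closure of T is self-adjoint; (ii) ker(T* + i·𝟙) = ker(T* − i·𝟙) = {0}; (iii) the ranges of T + i·𝟙 and T − i·𝟙 are both dense in H. -/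
open scoped ComplexInnerProductSpace

section Helpers

variable {H : Type*} [NormedAddCommGroup H] [InnerProductSpace ℂ H] [CompleteSpace H]

theorem aux_mem_adj (T : H →ₗ.[ℂ] H) (hd : Dense (T.domain : Set H)) (x y : H) :
    (x, y) ∈ T.adjoint.graph ↔ ∀ ψ : T.domain, ⟪T ψ, x⟫ = ⟪(ψ : H), y⟫ := by
  rw [LinearPMap.adjoint_graph_eq_graph_adjoint hd, Submodule.mem_adjoint_iff]
  constructor
  · intro h ψ
    exact sub_eq_zero.1 (h ψ (T ψ) (T.mem_graph ψ))
  · intro h a b hab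
    obtain ⟨ψ, h1, h2⟩ := (LinearPMap.mem_graph_iff T).1 hab
    simp only at h1 h2
    rw [← h1, ← h2, h ψ, sub_self]

theorem aux_ker (T : H →ₗ.[ℂ] H) (c : ℂ) :
    (∀ φ : T.adjoint.domain, T.adjoint φ - c • (φ : H) = 0 → (φ : H) = 0) ↔
      ∀ x : H, (x, c • x) ∈ T.adjoint.graph → x = 0 := by
  constructor
  · intro h x hx
    obtain ⟨φ, h1, h2⟩ := (LinearPMap.mem_graph_iff _).1 hx
    simp only at h1 h2
    rw [← h1]
    apply h φ
    rw [h2, h1, sub_self]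
  · intro h φ hφ
    apply h
    rw [← sub_eq_zero.1 hφ]
    exact T.adjoint.mem_graph φ

theorem aux_range (T : H →ₗ.[ℂ] H) (hd : Dense (T.domain : Set H)) (c : ℂ) :
    Dense (Set.range fun ψ : T.domain => T ψ - c • (ψ : H)) ↔
      ∀ x : H, (x, (starRingEnd ℂ c) • x) ∈ T.adjoint.graph → x = 0 := by
  have e : (Set.range fun ψ : T.domain => T ψ - c • (ψ : H)) =
      ((LinearMap.range (T.toFun - c • T.domain.subtype) : Submodule ℂ H) : Set H) := by
    ext x
    simp [LinearPMap.toFun_eq_coe]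
  rw [e, Submodule.dense_iff_topologicalClosure_eq_top,
    Submodule.topologicalClosure_eq_top_iff, Submodule.eq_bot_iff]
  refine forall_congr' fun x => imp_congr_left ?_
  rw [aux_mem_adj T hd, Submodule.mem_orthogonal]
  have key : ∀ ψ : T.domain, ⟪(T.toFun - c • T.domain.subtype) ψ, x⟫ = 0 ↔
      ⟪T ψ, x⟫ = ⟪(ψ : H), (starRingEnd ℂ c) • x⟫ := by
    intro ψ
    have : (T.toFun - c • T.domain.subtype) ψ = T ψ - c • (ψ : H) := rfl
    rw [this, inner_sub_left, inner_smul_left, inner_smul_right, sub_eq_zero]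
  constructor
  · intro h ψ
    exact (key ψ).1 (h _ ⟨ψ, rfl⟩)
  · rintro h _ ⟨ψ, rfl⟩
    exact (key ψ).2 (h ψ)

end Helpers

/-- basic criterion for essential self-adjointness. For a densely defined
symmetric operator `T` on a complex Hilbert space `H`, the following are equivalent:
(i) `T` is essentially self-adjoint (the closure of `T` is self-adjoint);
(ii) `ker (T* + i) = ker (T* - i) = {0}`;
(iii) the ranges of `T + i` and `T - i` are dense in `H`. -/
theorem stmt_1 {H : Type*} [NormedAddCommGroup H] [InnerProductSpace ℂ H] [CompleteSpace H]
    (T : H →ₗ.[ℂ] H) (hdense : Dense (T.domain : Set H))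
    (hsymm : ∀ φ ψ : T.domain, ⟪T φ, (ψ : H)⟫ = ⟪(φ : H), T ψ⟫) :
    [ T.closure.adjoint = T.closure,
      (∀ φ : T.adjoint.domain, T.adjoint φ + Complex.I • (φ : H) = 0 → (φ : H) = 0) ∧
        (∀ φ : T.adjoint.domain, T.adjoint φ - Complex.I • (φ : H) = 0 → (φ : H) = 0),
      Dense (Set.range fun ψ : T.domain => T ψ + Complex.I • (ψ : H)) ∧
        Dense (Set.range fun ψ : T.domain => T ψ - Complex.I • (ψ : H)) ].TFAE := by
  have hle : T ≤ T.adjoint := LinearPMap.IsFormalAdjoint.le_adjoint hdense hsymm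
  have hAcl : T.adjoint.IsClosed := LinearPMap.adjoint_isClosed hdense
  have hcl : T.IsClosable := hAcl.isClosable.leIsClosable hle
  have hC : T.closure.graph = T.graph.topologicalClosure :=
    hcl.graph_closure_eq_closure_graph.symm
  have hCA : T.closure.graph ≤ T.adjoint.graph := by
    rw [hC]
    exact Submodule.topologicalClosure_minimal _ (LinearPMap.le_graph_of_le hle) hAcl
  have hdC : Dense (T.closure.domain : Set H) := hdense.mono T.le_closure.1
  have hadj : T.closure.adjoint = T.adjoint := by
    apply LinearPMap.eq_of_eq_graph
    ext ⟨x, y⟩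
    constructor
    · intro h
      rw [aux_mem_adj _ hdense]
      intro ψ
      have h2 : ((ψ : H), T ψ) ∈ T.closure.graph :=
        LinearPMap.le_graph_of_le T.le_closure (T.mem_graph ψ)
      obtain ⟨φ, h3, h4⟩ := (LinearPMap.mem_graph_iff _).1 h2
      simp only at h3 h4
      have := (aux_mem_adj _ hdC x y).1 h φ
      rwa [h3, h4] at this
    · intro h
      rw [aux_mem_adj _ hdC]
      intro φ
      have hm : ((φ : H), T.closure φ) ∈ closure (T.graph : Set (H × H)) := by
        have := T.closure.mem_graph φ
        rw [hC] at this
        exact this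
      have hclosed : IsClosed {p : H × H | ⟪p.2, x⟫ = ⟪p.1, y⟫} :=
        isClosed_eq (by fun_prop) (by fun_prop)
      refine closure_minimal ?_ hclosed hm
      rintro ⟨a, b⟩ hab
      obtain ⟨ψ, h1, h2⟩ := (LinearPMap.mem_graph_iff T).1 hab
      simp only at h1 h2
      change ⟪b, x⟫ = ⟪a, y⟫
      rw [← h1, ← h2]
      exact (aux_mem_adj _ hdense x y).1 h ψ
  have k1 := aux_ker T (-Complex.I)
  have k2 := aux_ker T (Complex.I)
  have r1 := aux_range T hdense (-Complex.I)
  have r2 := aux_range T hdense (Complex.I)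
  simp only [map_neg, Complex.conj_I, neg_neg] at r1 r2
  simp only [neg_smul Complex.I, sub_neg_eq_add] at k1 r1
  rw [hadj, k1, k2, r1, r2]
  tfae_have 2 ↔ 3 := by
    simp only [neg_smul]
    exact and_comm
  tfae_have 1 → 2 := by
    intro h
    have hs : ∀ x y : H, (x, y) ∈ T.adjoint.graph → ⟪y, x⟫ = ⟪x, y⟫ := by
      intro x y hxy
      have h1 := hxy
      rw [← hadj, aux_mem_adj _ hdC] at h1
      rw [h] at hxy
      obtain ⟨φ, h3, h4⟩ := (LinearPMap.mem_graph_iff _).1 hxy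
      simp only at h3 h4
      have := h1 φ
      rwa [h3, h4] at this
    have hz : ∀ (c : ℂ) (x : H), starRingEnd ℂ c ≠ c → (x, c • x) ∈ T.adjoint.graph → x = 0 := by
      intro c x hc hx
      have := hs _ _ hx
      rw [inner_smul_left, inner_smul_right] at this
      by_contra h0
      exact hc (mul_right_cancel₀ (inner_self_ne_zero.2 h0) this)
    have hI : (-Complex.I) ≠ Complex.I := by
      intro h
      have := congrArg Complex.im h
      norm_num at this
    constructor
    · intro x hx
      refine hz (-Complex.I) x ?_ (by simpa using hx)
      simpa using hI.symm
    · intro x hx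
      refine hz (Complex.I) x ?_ (by simpa using hx)
      simpa using hI
  tfae_have 2 → 1 := by
    intro h
    have hD : Dense (Set.range fun ψ : T.domain => T ψ + Complex.I • (ψ : H)) :=
      r1.2 h.2
    apply LinearPMap.eq_of_eq_graph
    refine le_antisymm ?_ hCA
    rintro ⟨x, y⟩ hxy
    have hnorm : ∀ ψ : T.domain, ‖T ψ + Complex.I • (ψ : H)‖ ^ 2 =
        ‖T ψ‖ ^ 2 + ‖(ψ : H)‖ ^ 2 := by
      intro ψ
      have him : (⟪T ψ, (ψ : H)⟫).im = 0 := by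
        have h1 : starRingEnd ℂ ⟪T ψ, (ψ : H)⟫ = ⟪T ψ, (ψ : H)⟫ := by
          rw [inner_conj_symm, hsymm]
        exact Complex.conj_eq_iff_im.1 h1
      rw [@norm_add_sq ℂ, inner_smul_right, norm_smul]
      simp [him]
    obtain ⟨u, hu, hlim⟩ := mem_closure_iff_seq_limit.1 (hD (y + Complex.I • x))
    choose ψ hψ using hu
    have hdiff : ∀ m n, u m - u n = T (ψ m - ψ n) + Complex.I • ((ψ m - ψ n : T.domain) : H) := by
      intro m n
      rw [← hψ m, ← hψ n, LinearPMap.map_sub]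
      simp only [Submodule.coe_sub, smul_sub]
      abel
    have hcu := hlim.cauchySeq
    have c1 : CauchySeq fun n => (ψ n : H) := by
      rw [Metric.cauchySeq_iff] at hcu ⊢
      intro ε hε
      obtain ⟨N, hN⟩ := hcu ε hε
      refine ⟨N, fun m hm n hn => lt_of_le_of_lt ?_ (hN m hm n hn)⟩
      rw [dist_eq_norm, dist_eq_norm, hdiff, ← Submodule.coe_sub]
      refine (pow_le_pow_iff_left₀ (norm_nonneg _) (norm_nonneg _) two_ne_zero).1 ?_
      rw [hnorm]
      exact le_add_of_nonneg_left (sq_nonneg _)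
    obtain ⟨a, ha⟩ := cauchySeq_tendsto_of_complete c1
    have hb : Filter.Tendsto (fun n => T (ψ n)) Filter.atTop
        (nhds (y + Complex.I • x - Complex.I • a)) := by
      have := hlim.sub (ha.const_smul Complex.I)
      refine this.congr fun n => ?_
      rw [← hψ n]
      simp
    have hab : (a, y + Complex.I • x - Complex.I • a) ∈ T.closure.graph := by
      rw [hC]
      exact mem_closure_of_tendsto (ha.prodMk_nhds hb)
        (Filter.Eventually.of_forall fun n => T.mem_graph (ψ n))
    have hsub := T.adjoint.graph.sub_mem hxy (hCA hab)
    have hxa : x - a = 0 := by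
      apply h.1
      convert hsub using 1
      ext
      · rfl
      · simp only [Prod.snd_sub, smul_sub, neg_smul]
        abel
    have hxa' : x = a := sub_eq_zero.1 hxa
    rw [← hxa'] at hab
    simpa using hab
  tfae_finish
end

section
/- Let H be a complex Hilbert space, let A be a linear operator with domain D_A ⊆ H and B a linear operator with domain D_B ⊇ D_A. Suppose that for every t ∈ [0,1] the operator A + tB (with domain D_A) is dissipative, i.e. Re⟪(A + tB)x, x⟫ ≤ 0 for all x ∈ D_A; that there exist constants 0 ≤ α < 1 and β ≥ 0 with ‖Bx‖ ≤ α‖Ax‖ + β‖x‖ for all x ∈ D_A; and that for some t₀ ∈ [0,1] the operator A + t₀B is m-dissipative, i.e. 𝟙 − (A + t₀B) is surjective onto H. Then A + tB is m-dissipative for every t ∈ [0,1]; in particular 𝟙 − (A + tB) is surjective onto H for every t ∈ [0,1]. -/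
open scoped ComplexInnerProductSpace

/-- Small perturbation of a surjective operator, by the contraction principle. -/
lemma surj_step_aux {D H : Type*} [AddCommGroup D] [Module ℂ D] [NormedAddCommGroup H]
    [InnerProductSpace ℂ H] [CompleteSpace H] (T B : D →ₗ[ℂ] H) (C c : ℝ)
    (hb : ∀ x, ‖B x‖ ≤ C * ‖T x‖) (hc : |c| * C ≤ 1 / 2) (hT : Function.Surjective T) :
    Function.Surjective (T - (c : ℂ) • B) := by
  intro y
  choose R hR using hT
  have hK : ContractingWith (1 / 2 : NNReal) (fun z => y + (c : ℂ) • B (R z)) := by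
    refine ⟨by rw [← NNReal.coe_lt_coe]; norm_num, LipschitzWith.of_dist_le_mul ?_⟩
    intro z w
    have h1 := hb (R z - R w)
    rw [map_sub, map_sub, hR, hR] at h1
    rw [dist_eq_norm, dist_eq_norm, add_sub_add_left_eq_sub, ← smul_sub, norm_smul,
      Complex.norm_real, Real.norm_eq_abs]
    have h2 := mul_le_mul_of_nonneg_left h1 (abs_nonneg c)
    have h3 := mul_le_mul_of_nonneg_right hc (norm_nonneg (z - w))
    push_cast
    linarith
  have hz := hK.fixedPoint_isFixedPt
  set z := ContractingWith.fixedPoint _ hK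
  refine ⟨R z, ?_⟩
  have hz' : y + (c : ℂ) • B (R z) = z := hz
  simp only [LinearMap.sub_apply, LinearMap.smul_apply, hR]
  nth_rewrite 1 [← hz']
  abel

/-- Continuation along `[0,1]` with a uniform step. -/
lemma continuation_aux (P : ℝ → Prop) (δ : ℝ) (hδ : 0 < δ)
    (hstep : ∀ s ∈ Set.Icc (0 : ℝ) 1, ∀ t ∈ Set.Icc (0 : ℝ) 1, |t - s| ≤ δ → P s → P t) :
    ∀ s ∈ Set.Icc (0 : ℝ) 1, ∀ t ∈ Set.Icc (0 : ℝ) 1, P s → P t := by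
  have key : ∀ n : ℕ, ∀ s ∈ Set.Icc (0 : ℝ) 1, ∀ t ∈ Set.Icc (0 : ℝ) 1,
      |t - s| ≤ n * δ → P s → P t := by
    intro n
    induction n with
    | zero =>
      intro s hs t ht h
      exact hstep s hs t ht (by push_cast at h; linarith)
    | succ n ih =>
      intro s hs t ht h hP
      push_cast at h
      by_cases h0 : |t - s| ≤ δ
      · exact hstep s hs t ht h0 hP
      push Not at h0
      rcases le_total s t with hst | hst
      · rw [abs_of_nonneg (by linarith)] at h h0
        have hu : s + δ ∈ Set.Icc (0 : ℝ) 1 := ⟨by linarith [hs.1], by linarith [ht.2]⟩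
        refine ih (s + δ) hu t ht ?_ (hstep s hs _ hu ?_ hP)
        · rw [abs_of_nonneg (by linarith)]; linarith
        · rw [abs_of_nonneg (by linarith)]; linarith
      · rw [abs_of_nonpos (by linarith)] at h h0
        have hu : s - δ ∈ Set.Icc (0 : ℝ) 1 := ⟨by linarith [ht.1], by linarith [hs.2]⟩
        refine ih (s - δ) hu t ht ?_ (hstep s hs _ hu ?_ hP)
        · rw [abs_of_nonpos (by linarith)]; linarith
        · rw [abs_of_nonpos (by linarith)]; linarith
  intro s hs t ht
  obtain ⟨n, hn⟩ := exists_nat_ge (|t - s| / δ)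
  exact key n s hs t ht ((div_le_iff₀ hδ).1 hn)

/-- perturbation theorem for m-dissipative operators. Let `A, B` be linear
operators on a complex Hilbert space `H` with `D_A ⊆ D_B`. Suppose `A + tB` (with domain `D_A`)
is dissipative for every `t ∈ [0,1]`, that `‖Bx‖ ≤ α‖Ax‖ + β‖x‖` on `D_A` with `0 ≤ α < 1`,
`β ≥ 0`, and that `A + t₀B` is m-dissipative (`𝟙 − (A + t₀B)` is surjective) for some
`t₀ ∈ [0,1]`. Then `A + tB` is m-dissipative for every `t ∈ [0,1]`. -/
theorem stmt_19 {H : Type*} [NormedAddCommGroup H] [InnerProductSpace ℂ H] [CompleteSpace H]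
    (A B : H →ₗ.[ℂ] H) (hAB : A.domain ≤ B.domain)
    (hdiss : ∀ t ∈ Set.Icc (0 : ℝ) 1, ∀ x : A.domain,
      (⟪A x + (t : ℂ) • B ⟨(x : H), hAB x.2⟩, (x : H)⟫).re ≤ 0)
    (α β : ℝ) (hα0 : 0 ≤ α) (hα1 : α < 1) (hβ : 0 ≤ β)
    (hbound : ∀ x : A.domain, ‖B ⟨(x : H), hAB x.2⟩‖ ≤ α * ‖A x‖ + β * ‖(x : H)‖)
    (t₀ : ℝ) (ht₀ : t₀ ∈ Set.Icc (0 : ℝ) 1)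
    (hsurj : ∀ y : H, ∃ x : A.domain,
      (x : H) - (A x + (t₀ : ℂ) • B ⟨(x : H), hAB x.2⟩) = y) :
    ∀ t ∈ Set.Icc (0 : ℝ) 1,
      (∀ x : A.domain, (⟪A x + (t : ℂ) • B ⟨(x : H), hAB x.2⟩, (x : H)⟫).re ≤ 0) ∧
      (∀ y : H, ∃ x : A.domain,
        (x : H) - (A x + (t : ℂ) • B ⟨(x : H), hAB x.2⟩) = y) := by
  intro t ht
  refine ⟨hdiss t ht, ?_⟩
  let B' : A.domain →ₗ[ℂ] H := B.toFun.comp (Submodule.inclusion hAB)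
  let S : ℝ → A.domain →ₗ[ℂ] H := fun t => A.domain.subtype - (A.toFun + (t : ℂ) • B')
  have hS : ∀ (t : ℝ) (x : A.domain),
    S t x = (x : H) - (A x + (t : ℂ) • B ⟨(x : H), hAB x.2⟩) := fun t x => rfl
  have hB' : ∀ x : A.domain, B' x = B ⟨(x : H), hAB x.2⟩ := fun x => rfl
  -- dissipativity gives `‖x‖ ≤ ‖S t x‖`
  have hx : ∀ t ∈ Set.Icc (0 : ℝ) 1, ∀ x : A.domain, ‖(x : H)‖ ≤ ‖S t x‖ := by
    intro t ht x
    have h1 := hdiss t ht x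
    have h2 : (⟪S t x, (x : H)⟫).re ≤ ‖S t x‖ * ‖(x : H)‖ :=
      (Complex.re_le_norm _).trans (norm_inner_le_norm _ _)
    have h4 : (⟪(x : H), (x : H)⟫).re = ‖(x : H)‖ ^ 2 := by
      rw [inner_self_eq_norm_sq_to_K]
      norm_cast
    have h3 : (⟪S t x, (x : H)⟫).re = ‖(x : H)‖ ^ 2
        - (⟪A x + (t : ℂ) • B ⟨(x : H), hAB x.2⟩, (x : H)⟫).re := by
      rw [hS, inner_sub_left, Complex.sub_re, h4]
    rcases (norm_nonneg (x : H)).eq_or_lt with h0 | h0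
    · rw [← h0]; exact norm_nonneg _
    · refine le_of_mul_le_mul_right ?_ h0
      nlinarith
  set M : ℝ := (2 + β) / (1 - α) with hM
  have hM0 : 0 ≤ M := div_nonneg (by linarith) (by linarith)
  have hMe : M * (1 - α) = 2 + β := div_mul_cancel₀ _ (by linarith)
  set C : ℝ := α * M + β with hC
  have hC0 : 0 ≤ C := by positivity
  have hBb : ∀ t ∈ Set.Icc (0 : ℝ) 1, ∀ x : A.domain, ‖B' x‖ ≤ C * ‖S t x‖ := by
    intro t ht x
    have h1 := hx t ht x
    have h2 := hbound x
    rw [← hB'] at h2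
    have h3 : A x = (x : H) - S t x - (t : ℂ) • B' x := by rw [hS, hB']; abel
    have h4 : ‖A x‖ ≤ ‖(x : H)‖ + ‖S t x‖ + ‖B' x‖ := by
      rw [h3]
      refine (norm_sub_le _ _).trans (add_le_add (norm_sub_le _ _) ?_)
      rw [norm_smul, Complex.norm_real, Real.norm_eq_abs, abs_of_nonneg ht.1]
      exact mul_le_of_le_one_left (norm_nonneg _) ht.2
    have h5 : β * ‖(x : H)‖ ≤ β * ‖S t x‖ := mul_le_mul_of_nonneg_left h1 hβ
    have h6 : ‖A x‖ ≤ M * ‖S t x‖ := by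
      rw [hM, div_mul_eq_mul_div, le_div_iff₀ (by linarith)]
      linarith
    have h7 := mul_le_mul_of_nonneg_left h6 hα0
    rw [hC]
    linarith
  have hfin := continuation_aux (fun t => Function.Surjective (S t)) (1 / (2 * (C + 1)))
    (by positivity) (by
      intro s hs t ht hst hP
      have h : S t = S s - ((t - s : ℝ) : ℂ) • B' := by
        simp only [S]
        push_cast
        module
      simp only [h]
      refine surj_step_aux _ _ C _ (hBb s hs) ?_ hP
      rw [le_div_iff₀ (by positivity)] at hst
      nlinarith [abs_nonneg (t - s)]) t₀ ht₀ t ht hsurj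
  exact hfin
end
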